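/- Projection onto the group-norm ball: let X ∈ ℝ^{m×n} and λ > 0 with ‖X‖_{1,2} > λ. Then there exists a unique μ⋆ > 0 such that Σ_{i=1}^m max(‖X_{i,:}‖ − μ⋆, 0) = λ, and the matrix S_{μ⋆}(X), whose i-th row is X_{i,:}·(1 − μ⋆/max(‖X_{i,:}‖, μ⋆)), is the unique minimizer of Z ↦ ‖Z − X‖_F over the set {Z ∈ ℝ^{m×n} : ‖Z‖_{1,2} ≤ λ}; i.e., S_{μ⋆}(X) is the orthogonal (Frobenius-norm) projection of X onto the group-norm ball of radius λ. -/

import Mathlib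

open Real
open scoped BigOperators

noncomputable section

/-- Euclidean norm of the `i`-th row of a matrix. -/
def rowNorm {m n : ℕ} (X : Matrix (Fin m) (Fin n) ℝ) (i : Fin m) : ℝ :=
  Real.sqrt (∑ j, X i j ^ 2)

/-- The group norm `‖X‖_{1,2} = ∑ᵢ ‖X_{i,:}‖`. -/
def groupNorm {m n : ℕ} (X : Matrix (Fin m) (Fin n) ℝ) : ℝ :=
  ∑ i, rowNorm X i

/-- The Frobenius norm `‖X‖_F = (∑_{i,j} X_{ij}²)^{1/2}`. -/
def frobNorm {m n : ℕ} (X : Matrix (Fin m) (Fin n) ℝ) : ℝ :=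
  Real.sqrt (∑ i, ∑ j, X i j ^ 2)

/-- Row-wise shrinkage: `S_μ(X)_{i,:} = X_{i,:}·(1 - μ/max(‖X_{i,:}‖, μ))`. -/
def rowShrink {m n : ℕ} (μ : ℝ) (X : Matrix (Fin m) (Fin n) ℝ) : Matrix (Fin m) (Fin n) ℝ :=
  fun i j => X i j * (1 - μ / max (rowNorm X i) μ)

theorem aux_strict {m : ℕ} (r : Fin m → ℝ) (lam a b : ℝ) (hlam : 0 < lam) (hab : a < b)
    (hb : (∑ i, max (r i - b) 0) = lam) : lam < ∑ i, max (r i - a) 0 := by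
  have h1 : ∃ i, 0 < max (r i - b) 0 := by
    by_contra! h
    have : (∑ i, max (r i - b) 0) ≤ 0 := Finset.sum_nonpos (fun i _ => h i)
    linarith
  obtain ⟨i, hi⟩ := h1
  rw [← hb]
  apply Finset.sum_lt_sum
  · intro j _
    exact max_le_max (by linarith) le_rfl
  · refine ⟨i, Finset.mem_univ _, ?_⟩
    have : 0 < r i - b := by
      rcases lt_max_iff.1 hi with h | h
      · exact h
      · exact absurd h (lt_irrefl _)
    rw [max_eq_left this.le, max_eq_left (by linarith)]
    linarith

theorem aux_rowNorm_nonneg {m n : ℕ} (X : Matrix (Fin m) (Fin n) ℝ) (i : Fin m) :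
    0 ≤ rowNorm X i := Real.sqrt_nonneg _

theorem aux_rowNorm_sq {m n : ℕ} (X : Matrix (Fin m) (Fin n) ℝ) (i : Fin m) :
    ∑ j, X i j ^ 2 = rowNorm X i ^ 2 :=
  (Real.sq_sqrt (Finset.sum_nonneg fun j _ => sq_nonneg _)).symm

theorem aux_coef (r μ : ℝ) (hr : 0 ≤ r) (hμ : 0 < μ) :
    0 ≤ μ / max r μ ∧ μ / max r μ ≤ 1 ∧ (μ / max r μ) * r ≤ μ ∧
      r * (1 - μ / max r μ) = max (r - μ) 0 ∧
      (μ / max r μ) * (1 - μ / max r μ) * r ^ 2 = μ * max (r - μ) 0 := by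
  rcases le_total μ r with h | h
  · have hr0 : 0 < r := by linarith
    rw [max_eq_left h, max_eq_left (by linarith : (0:ℝ) ≤ r - μ)]
    refine ⟨by positivity, (div_le_one hr0).2 h, ?_, ?_, ?_⟩
    · rw [div_mul_cancel₀ _ hr0.ne']
    · field_simp
    · field_simp
  · rw [max_eq_right h, max_eq_right (by linarith : r - μ ≤ 0), div_self hμ.ne']
    norm_num
    exact h

theorem aux_rowNorm_shrink {m n : ℕ} (X : Matrix (Fin m) (Fin n) ℝ) (μ : ℝ) (hμ : 0 < μ)
    (i : Fin m) : rowNorm (rowShrink μ X) i = max (rowNorm X i - μ) 0 := by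
  obtain ⟨h0, h1, -, h3, -⟩ := aux_coef (rowNorm X i) μ (aux_rowNorm_nonneg X i) hμ
  rw [← h3]
  have : ∑ j, rowShrink μ X i j ^ 2 = (rowNorm X i * (1 - μ / max (rowNorm X i) μ)) ^ 2 := by
    simp only [rowShrink, mul_pow]
    rw [← Finset.sum_mul, aux_rowNorm_sq]
  rw [rowNorm, this]
  exact Real.sqrt_sq (mul_nonneg (aux_rowNorm_nonneg X i) (by linarith))

theorem aux_row {m n : ℕ} (X Z : Matrix (Fin m) (Fin n) ℝ) (μ : ℝ) (hμ : 0 < μ) (i : Fin m) :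
    μ * (max (rowNorm X i - μ) 0 - rowNorm Z i) ≤
      ∑ j, (Z i j - rowShrink μ X i j) * (rowShrink μ X i j - X i j) := by
  obtain ⟨h0, h1, h2, -, h4⟩ := aux_coef (rowNorm X i) μ (aux_rowNorm_nonneg X i) hμ
  have hcs : ∑ j, Z i j * X i j ≤ rowNorm Z i * rowNorm X i :=
    Real.sum_mul_le_sqrt_mul_sqrt _ _ _
  have hZ := aux_rowNorm_nonneg Z i
  have e : ∑ j, (Z i j - rowShrink μ X i j) * (rowShrink μ X i j - X i j) =
      (μ / max (rowNorm X i) μ) * (1 - μ / max (rowNorm X i) μ) * rowNorm X i ^ 2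
       - (μ / max (rowNorm X i) μ) * ∑ j, Z i j * X i j := by
    rw [← aux_rowNorm_sq, Finset.mul_sum, Finset.mul_sum, ← Finset.sum_sub_distrib]
    refine Finset.sum_congr rfl fun j _ => ?_
    simp only [rowShrink]
    ring
  rw [e, h4]
  have a1 := mul_le_mul_of_nonneg_left hcs h0
  have a2 := mul_le_mul_of_nonneg_left h2 hZ
  nlinarith

/-- Projection onto the group-norm ball: if `‖X‖_{1,2} > λ > 0`, there is a unique `μ⋆ > 0`
with `∑ᵢ max(‖X_{i,:}‖ - μ⋆, 0) = λ`, and `S_{μ⋆}(X)` is the unique Frobenius-norm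
projection of `X` onto `{Z : ‖Z‖_{1,2} ≤ λ}`. -/
theorem proj_group_norm_ball (m n : ℕ) (X : Matrix (Fin m) (Fin n) ℝ) (lam : ℝ)
    (hlam : 0 < lam) (hX : lam < groupNorm X) :
    ∃ μstar : ℝ, 0 < μstar ∧
      (∑ i, max (rowNorm X i - μstar) 0) = lam ∧
      (∀ μ' : ℝ, 0 < μ' → (∑ i, max (rowNorm X i - μ') 0) = lam → μ' = μstar) ∧
      groupNorm (rowShrink μstar X) ≤ lam ∧
      (∀ Z : Matrix (Fin m) (Fin n) ℝ, groupNorm Z ≤ lam → Z ≠ rowShrink μstar X →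
        frobNorm (rowShrink μstar X - X) < frobNorm (Z - X)) := by
  have hcont : Continuous fun μ : ℝ => ∑ i, max (rowNorm X i - μ) 0 := by fun_prop
  have hG : 0 ≤ groupNorm X := by linarith
  have hf0 : (∑ i, max (rowNorm X i - 0) 0) = groupNorm X := by
    refine Finset.sum_congr rfl fun i _ => ?_
    rw [sub_zero, max_eq_left (aux_rowNorm_nonneg X i)]
  have hf1 : (∑ i, max (rowNorm X i - groupNorm X) 0) = 0 := by
    refine Finset.sum_eq_zero fun i _ => ?_
    apply max_eq_right
    have : rowNorm X i ≤ groupNorm X :=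
      Finset.single_le_sum (fun i _ => aux_rowNorm_nonneg X i) (Finset.mem_univ i)
    linarith
  obtain ⟨μ, hμm, hμ⟩ := intermediate_value_Icc' hG hcont.continuousOn
    (show lam ∈ Set.Icc (∑ i, max (rowNorm X i - groupNorm X) 0)
      (∑ i, max (rowNorm X i - 0) 0) by
        rw [hf0, hf1]; exact ⟨hlam.le, hX.le⟩)
  have hμ : (∑ i, max (rowNorm X i - μ) 0) = lam := hμ
  have hpos : 0 < μ := by
    rcases hμm.1.lt_or_eq with h | h
    · exact h
    · rw [← h, hf0] at hμ
      linarith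
  refine ⟨μ, hpos, hμ, ?_, ?_, ?_⟩
  · intro μ' _ h'
    rcases lt_trichotomy μ' μ with h | h | h
    · have := aux_strict _ lam μ' μ hlam h hμ
      linarith
    · exact h
    · have := aux_strict _ lam μ μ' hlam h h'
      linarith
  · rw [← hμ]
    exact (Finset.sum_congr rfl fun i _ => aux_rowNorm_shrink X μ hpos i).le
  · intro Z hZ hne
    apply Real.sqrt_lt_sqrt (Finset.sum_nonneg fun i _ => Finset.sum_nonneg fun j _ => sq_nonneg _)
    simp only [Matrix.sub_apply]
    have hin : 0 ≤ ∑ i, ∑ j, (Z i j - rowShrink μ X i j) * (rowShrink μ X i j - X i j) := by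
      have h1 := Finset.sum_le_sum fun i (_ : i ∈ Finset.univ) => aux_row X Z μ hpos i
      rw [← Finset.mul_sum, Finset.sum_sub_distrib, hμ] at h1
      have h2 : 0 ≤ μ * (lam - ∑ i, rowNorm Z i) :=
        mul_nonneg hpos.le (sub_nonneg.2 hZ)
      exact h2.trans h1
    have hpd : 0 < ∑ i, ∑ j, (Z i j - rowShrink μ X i j) ^ 2 := by
      have : ∃ i j, Z i j ≠ rowShrink μ X i j := by
        by_contra! h
        exact hne (Matrix.ext h)
      obtain ⟨i, j, hij⟩ := this
      refine Finset.sum_pos' (fun i _ => Finset.sum_nonneg fun j _ => sq_nonneg _)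
        ⟨i, Finset.mem_univ _, Finset.sum_pos' (fun j _ => sq_nonneg _) ⟨j, Finset.mem_univ _, ?_⟩⟩
      have := sub_ne_zero.2 hij
      positivity
    have e : ∑ i, ∑ j, (Z i j - X i j) ^ 2 = ∑ i, ∑ j, (rowShrink μ X i j - X i j) ^ 2
        + ∑ i, ∑ j, (Z i j - rowShrink μ X i j) ^ 2
        + 2 * ∑ i, ∑ j, (Z i j - rowShrink μ X i j) * (rowShrink μ X i j - X i j) := by
      simp only [Finset.mul_sum, ← Finset.sum_add_distrib]
      refine Finset.sum_congr rfl fun i _ => Finset.sum_congr rfl fun j _ => ?_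
      ring
    rw [e]
    linarith
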